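/- For every real x with 0 < x < 1/(12√3), the real number u(x) := (1/(24x))·(1 + 2·sin((2/3)·arcsin(12√3·x) − π/6)) satisfies the cubic equation 8x·u(x)^3 − u(x)^2 + 1 = 0; moreover u(x) → 1 as x → 0 from the right. -/

import Mathlib

open Real Filter

/-- The closed-form spherical generating function `u⁽⁰⁾` of the cubic matrix model. -/
noncomputable def cubicSphericalU (x : ℝ) : ℝ :=
  1 / (24 * x) * (1 + 2 * Real.sin (2 / 3 * Real.arcsin (12 * Real.sqrt 3 * x) - Real.pi / 6))

/-- The numerator of `cubicSphericalU` has derivative `24` at the origin. -/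
lemma hasDerivAt_cubicSphericalU_numerator :
    HasDerivAt (fun x : ℝ => 1 + 2 * Real.sin (2 / 3 * Real.arcsin (12 * Real.sqrt 3 * x)
      - Real.pi / 6)) 24 0 := by
  have hlin : HasDerivAt (fun x : ℝ => 12 * Real.sqrt 3 * x) (12 * Real.sqrt 3) 0 := by
    simpa using (hasDerivAt_id (0 : ℝ)).const_mul (12 * Real.sqrt 3)
  have harcsin : HasDerivAt Real.arcsin 1 (12 * Real.sqrt 3 * 0) := by
    simpa using Real.hasDerivAt_arcsin (x := 0) (by norm_num) (by norm_num)
  have h := ((((harcsin.comp (0 : ℝ) hlin).const_mul (2 / 3)).sub_const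
    (Real.pi / 6)).sin.const_mul 2).const_add 1
  refine h.congr_deriv ?_
  have h3 : Real.sqrt 3 * Real.sqrt 3 = 3 := Real.mul_self_sqrt (by norm_num)
  simp only [Function.comp_apply, mul_zero, Real.arcsin_zero, zero_sub, Real.cos_neg,
    Real.cos_pi_div_six]
  linear_combination 8 * h3

/-- The triple-angle formula applied to the angle in `cubicSphericalU`. -/
lemma sin_two_thirds_arcsin_sub_cubic {y : ℝ} (h₁ : -1 ≤ y) (h₂ : y ≤ 1) :
    3 * Real.sin (2 / 3 * Real.arcsin y - Real.pi / 6)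
      - 4 * Real.sin (2 / 3 * Real.arcsin y - Real.pi / 6) ^ 3 = 2 * y ^ 2 - 1 := by
  rw [← Real.sin_three_mul, show 3 * (2 / 3 * Real.arcsin y - Real.pi / 6)
    = 2 * Real.arcsin y - Real.pi / 2 by ring, Real.sin_sub_pi_div_two, Real.cos_two_mul,
    Real.cos_sq', Real.sin_arcsin h₁ h₂]
  ring

/-- For `0 < x < 1/(12√3)`, `u(x)` satisfies `8x·u³ - u² + 1 = 0`, and `u(x) → 1`
as `x → 0⁺`. -/
theorem cubicSphericalU_cubic_equation :
    (∀ x : ℝ, 0 < x → x < 1 / (12 * Real.sqrt 3) →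
      8 * x * (cubicSphericalU x) ^ 3 - (cubicSphericalU x) ^ 2 + 1 = 0) ∧
    Tendsto cubicSphericalU (nhdsWithin 0 (Set.Ioi 0)) (nhds 1) := by
  constructor
  · intro x hx hx'
    have hpos : 0 < 12 * Real.sqrt 3 := by positivity
    have hy : 12 * Real.sqrt 3 * x ≤ 1 := by
      rw [lt_div_iff₀ hpos] at hx'
      linarith
    have hy' : -1 ≤ 12 * Real.sqrt 3 * x := by
      have := mul_pos hpos hx
      linarith
    have key := sin_two_thirds_arcsin_sub_cubic hy' hy
    have h3 : Real.sqrt 3 ^ 2 = 3 := Real.sq_sqrt (by norm_num)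
    unfold cubicSphericalU
    generalize Real.sin (2 / 3 * Real.arcsin (12 * Real.sqrt 3 * x) - Real.pi / 6) = s at key ⊢
    rw [mul_pow, mul_pow, h3] at key
    field_simp
    linear_combination (-16) * key
  · have h := hasDerivAt_cubicSphericalU_numerator.tendsto_slope_zero_right.const_mul (1 / 24)
    rw [show (1 / 24 : ℝ) * 24 = 1 by norm_num] at h
    refine h.congr fun x => ?_
    simp only [cubicSphericalU, zero_add, mul_zero, Real.arcsin_zero, zero_sub, Real.sin_neg,
      Real.sin_pi_div_six, smul_eq_mul, one_div, mul_inv]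
    ring
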